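/- For every integer n ≥ 2, the set of real numbers α such that (A+B)^{∘α} − A^{∘α} − B^{∘α} is positive semidefinite for all n×n real symmetric positive semidefinite matrices A, B with nonnegative entries equals ℕ ∪ [n, ∞), where ℕ denotes the positive integers. -/

import Mathlib

open Matrix

/-- Entrywise power with the convention `0 ^ α := 0` for all `α`. -/
noncomputable def powF (α x : ℝ) : ℝ := if x = 0 then 0 else x ^ α

/-- `ψ_α(x) := sgn(x) * |x| ^ α`, with `ψ_α(0) := 0`. -/
noncomputable def psiF (α x : ℝ) : ℝ := if x = 0 then 0 else Real.sign x * |x| ^ α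

/-- `φ_α(x) := |x| ^ α`, with `φ_α(0) := 0`. -/
noncomputable def phiF (α x : ℝ) : ℝ := if x = 0 then 0 else |x| ^ α

theorem had_psd {n : ℕ} {A B : Matrix (Fin n) (Fin n) ℝ} (hA : A.PosSemidef)
    (hB : B.PosSemidef) : (A ⊙ B).PosSemidef := PosSemidef.hadamard hA hB

theorem psd_iff {n : ℕ} (A : Matrix (Fin n) (Fin n) ℝ) :
    A.PosSemidef ↔ (∀ i j, A i j = A j i) ∧
      ∀ x : Fin n → ℝ, 0 ≤ ∑ i, ∑ j, x i * x j * A i j := by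
  rw [posSemidef_iff_dotProduct_mulVec]
  have h2 : ∀ x : Fin n → ℝ, star x ⬝ᵥ (A *ᵥ x) = ∑ i, ∑ j, x i * x j * A i j := by
    intro x
    simp only [dotProduct, mulVec, Finset.mul_sum, Pi.star_apply, star_trivial]
    refine Finset.sum_congr rfl fun i _ => Finset.sum_congr rfl fun j _ => by ring
  have h1 : A.IsHermitian ↔ ∀ i j, A i j = A j i := by
    rw [IsHermitian.ext_iff]
    simp only [star_trivial]
    exact ⟨fun h i j => h j i, fun h i j => h j i⟩
  rw [h1]
  simp only [h2]

/-- rank one matrices -/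
theorem psd_rankOne {n : ℕ} (u : Fin n → ℝ) :
    (Matrix.of fun i j => u i * u j : Matrix (Fin n) (Fin n) ℝ).PosSemidef := by
  have := posSemidef_vecMulVec_self_star u
  convert this using 1
  ext i j
  simp [vecMulVec_apply]

/-- Loewner growth along a segment, from positivity of the derivative. -/
theorem path_psd {n : ℕ} (C D : Matrix (Fin n) (Fin n) ℝ) (β : ℝ) (hβ : 1 ≤ β)
    (hC : ∀ i j, C i j = C j i) (hD : ∀ i j, D i j = D j i)
    (h : ∀ t : ℝ, 0 < t → t < 1 →
      (D ⊙ (C + t • D).map (fun y => y ^ (β - 1))).PosSemidef) :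
    ((C + D).map (fun y => y ^ β) - C.map (fun y => y ^ β)).PosSemidef := by
  rw [psd_iff]
  refine ⟨fun i j => by simp [hC i j, hD i j], fun x => ?_⟩
  have hder : ∀ t : ℝ, HasDerivAt
      (fun t : ℝ => ∑ i, ∑ j, x i * x j * (C i j + t * D i j) ^ β)
      (∑ i, ∑ j, x i * x j * (D i j * β * (C i j + t * D i j) ^ (β - 1))) t := by
    intro t
    refine HasDerivAt.fun_sum fun i _ => HasDerivAt.fun_sum fun j _ => ?_
    have h1 : HasDerivAt (fun t : ℝ => C i j + t * D i j) (D i j) t := by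
      simpa using ((hasDerivAt_id t).mul_const (D i j)).const_add (C i j)
    exact (h1.rpow_const (Or.inr hβ)).const_mul _
  have hmono : MonotoneOn (fun t : ℝ => ∑ i, ∑ j, x i * x j * (C i j + t * D i j) ^ β)
      (Set.Icc 0 1) := by
    refine monotoneOn_of_deriv_nonneg (convex_Icc 0 1)
      (fun t _ => (hder t).continuousAt.continuousWithinAt)
      (fun t _ => (hder t).differentiableAt.differentiableWithinAt) ?_
    intro t ht
    rw [interior_Icc] at ht
    rw [(hder t).deriv]
    have := ((psd_iff _).1 (h t ht.1 ht.2)).2 x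
    have e : (∑ i, ∑ j, x i * x j * (D i j * β * (C i j + t * D i j) ^ (β - 1)))
        = β * ∑ i, ∑ j, x i * x j *
          (D ⊙ (C + t • D).map (fun y => y ^ (β - 1))) i j := by
      simp only [Finset.mul_sum]
      refine Finset.sum_congr rfl fun i _ => Finset.sum_congr rfl fun j _ => ?_
      simp
      ring
    rw [e]
    exact mul_nonneg (by linarith) this
  have := hmono (Set.left_mem_Icc.2 zero_le_one) (Set.right_mem_Icc.2 zero_le_one) zero_le_one
  simp only [zero_mul, add_zero, one_mul] at this
  have e : (∑ i, ∑ j, x i * x j *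
      ((C + D).map (fun y => y ^ β) - C.map (fun y => y ^ β)) i j)
      = (∑ i, ∑ j, x i * x j * (C i j + D i j) ^ β) - ∑ i, ∑ j, x i * x j * (C i j) ^ β := by
    simp only [← Finset.sum_sub_distrib]
    refine Finset.sum_congr rfl fun i _ => Finset.sum_congr rfl fun j _ => ?_
    simp
    ring
  rw [e]
  linarith

theorem psd_quad_add {n : ℕ} (A : Matrix (Fin (n + 1)) (Fin (n + 1)) ℝ)
    (hs : ∀ i j, A i j = A j i) (x : Fin (n + 1) → ℝ) (s : ℝ) :
    (∑ i, ∑ j, (x i + s * Pi.single (M := fun _ => ℝ) 0 1 i) *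
      (x j + s * Pi.single (M := fun _ => ℝ) 0 1 j) * A i j)
    = (∑ i, ∑ j, x i * x j * A i j) + 2 * s * (∑ j, x j * A j 0) + s ^ 2 * A 0 0 := by
  have e : ∀ i j, (x i + s * Pi.single (M := fun _ => ℝ) 0 1 i) *
      (x j + s * Pi.single (M := fun _ => ℝ) 0 1 j) * A i j
      = x i * x j * A i j + s * (Pi.single (M := fun _ => ℝ) 0 1 i * (x j * A i j))
        + s * (x i * (Pi.single (M := fun _ => ℝ) 0 1 j * A i j))
        + s ^ 2 * (Pi.single (M := fun _ => ℝ) 0 1 i *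
            (Pi.single (M := fun _ => ℝ) 0 1 j * A i j)) := by
    intro i j; ring
  simp only [e, Finset.sum_add_distrib, ← Finset.mul_sum]
  simp only [Pi.single_apply, ite_mul, one_mul, zero_mul, Finset.sum_ite_eq',
    Finset.mem_univ, if_true]
  have : ∑ j, x j * A 0 j = ∑ j, x j * A j 0 :=
    Finset.sum_congr rfl fun j _ => by rw [hs 0 j]
  rw [this]
  ring

theorem psd_col_zero {n : ℕ} (A : Matrix (Fin (n + 1)) (Fin (n + 1)) ℝ)
    (hA : A.PosSemidef) (h0 : A 0 0 = 0) (j : Fin (n + 1)) : A j 0 = 0 := by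
  obtain ⟨hs, hq⟩ := (psd_iff A).1 hA
  by_contra hne
  have hj := hq (fun i => Pi.single (M := fun _ => ℝ) j 1 i
    + (-(A j j + 1) / (2 * A j 0)) * Pi.single (M := fun _ => ℝ) 0 1 i)
  rw [psd_quad_add A hs, h0] at hj
  simp only [Pi.single_apply, ite_mul, one_mul, zero_mul, Finset.sum_ite_eq', mul_ite, mul_zero,
    Finset.mem_univ, if_true, Finset.sum_ite_irrel, Finset.sum_const_zero] at hj
  field_simp at hj
  linarith

theorem schur_psd {n : ℕ} (A : Matrix (Fin (n + 1)) (Fin (n + 1)) ℝ)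
    (hA : A.PosSemidef) :
    (A - Matrix.of fun i j => A i 0 * A j 0 / A 0 0).PosSemidef := by
  obtain ⟨hs, hq⟩ := (psd_iff A).1 hA
  rw [psd_iff]
  refine ⟨fun i j => by simp [hs i j, mul_comm], fun x => ?_⟩
  have e : (∑ i, ∑ j, x i * x j * (A - Matrix.of fun i j => A i 0 * A j 0 / A 0 0) i j)
      = (∑ i, ∑ j, x i * x j * A i j) - (∑ j, x j * A j 0) ^ 2 / A 0 0 := by
    rw [pow_two, Finset.sum_mul_sum]
    simp only [Finset.sum_div, ← Finset.sum_sub_distrib]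
    refine Finset.sum_congr rfl fun i _ => Finset.sum_congr rfl fun j _ => ?_
    simp
    ring
  rw [e]
  rcases eq_or_ne (A 0 0) 0 with h0 | h0
  · rw [h0]; simpa using hq x
  · have := hq (fun i => x i + (-(∑ j, x j * A j 0) / A 0 0) * Pi.single (M := fun _ => ℝ) 0 1 i)
    rw [psd_quad_add A hs] at this
    have e2 : (∑ i, ∑ j, x i * x j * A i j) +
        2 * (-(∑ j, x j * A j 0) / A 0 0) * (∑ j, x j * A j 0) +
        (-(∑ j, x j * A j 0) / A 0 0) ^ 2 * A 0 0
        = (∑ i, ∑ j, x i * x j * A i j) - (∑ j, x j * A j 0) ^ 2 / A 0 0 := by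
      field_simp
      ring
    rwa [e2] at this

/-- FitzGerald-Horn positivity -/
theorem pow_psd (m : ℕ) : ∀ (γ : ℝ) (_ : (m : ℝ) < γ)
    (A : Matrix (Fin (m + 2)) (Fin (m + 2)) ℝ),
    A.PosSemidef → (∀ i j, 0 ≤ A i j) → (A.map (fun y => y ^ γ)).PosSemidef := by
  induction m with
  | zero =>
    intro γ hγ A hA hn
    norm_num at hγ
    have hS := schur_psd A hA
    obtain ⟨hs, hq⟩ := (psd_iff A).1 hA
    have h11 : A 1 0 ^ 2 ≤ A 0 0 * A 1 1 := by
      rcases eq_or_ne (A 0 0) 0 with h0 | h0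
      · rw [psd_col_zero A hA h0 1, h0]; simp
      · have := hS.diag_nonneg (i := 1)
        simp only [Matrix.sub_apply, Matrix.of_apply] at this
        have hp : 0 < A 0 0 := lt_of_le_of_ne (hn 0 0) (Ne.symm h0)
        rw [sub_nonneg, div_le_iff₀ hp] at this
        nlinarith
    have hp : (A 1 0 ^ γ) ^ 2 ≤ A 0 0 ^ γ * A 1 1 ^ γ := by
      rw [← Real.mul_rpow (hn _ _) (hn _ _)]
      calc (A 1 0 ^ γ) ^ 2 = (A 1 0 ^ 2) ^ γ := by
            rw [pow_two, pow_two, Real.mul_rpow (hn _ _) (hn _ _)]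
        _ ≤ _ := Real.rpow_le_rpow (by positivity) h11 hγ.le
    have ha : 0 ≤ A 0 0 ^ γ := Real.rpow_nonneg (hn _ _) _
    have hc : 0 ≤ A 1 1 ^ γ := Real.rpow_nonneg (hn _ _) _
    rw [psd_iff]
    refine ⟨fun i j => by simp [hs i j], fun x => ?_⟩
    have e : ∑ i, ∑ j, x i * x j * A.map (fun y => y ^ γ) i j
        = x 0 * x 0 * A 0 0 ^ γ + x 0 * x 1 * A 1 0 ^ γ
          + (x 1 * x 0 * A 1 0 ^ γ + x 1 * x 1 * A 1 1 ^ γ) := by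
      rw [← hs 0 1]
      simp only [Matrix.map_apply]
      exact (Fin.sum_univ_two _).trans (congrArg₂ _ (Fin.sum_univ_two _) (by
        rw [hs 0 1]; exact Fin.sum_univ_two _))
    rw [e]
    generalize A 0 0 ^ γ = a at *
    generalize A 1 0 ^ γ = b at *
    generalize A 1 1 ^ γ = c at *
    rcases eq_or_lt_of_le ha with h | h
    · subst h
      have hb : b = 0 := by nlinarith
      subst hb
      nlinarith [mul_nonneg hc (sq_nonneg (x 1))]
    · refine nonneg_of_mul_nonneg_right (a := a) ?_ h
      nlinarith [sq_nonneg (a * x 0 + b * x 1), mul_nonneg (sub_nonneg.2 hp) (sq_nonneg (x 1))]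
  | succ m ih =>
    intro γ hγ A hA hn
    push_cast at hγ
    have hm0 : (0 : ℝ) ≤ m := Nat.cast_nonneg m
    obtain ⟨hs, hq⟩ := (psd_iff A).1 hA
    set Z : Matrix (Fin (m + 1 + 2)) (Fin (m + 1 + 2)) ℝ :=
      Matrix.of fun i j => A i 0 * A j 0 / A 0 0 with hZ
    have hS : (A - Z).PosSemidef := schur_psd A hA
    have hZn : ∀ i j, 0 ≤ Z i j := fun i j =>
      div_nonneg (mul_nonneg (hn _ _) (hn _ _)) (hn _ _)
    have hZs : ∀ i j, Z i j = Z j i := fun i j => by simp [hZ, mul_comm]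
    have hcol : ∀ j, (A - Z) j 0 = 0 := by
      intro j
      rcases eq_or_ne (A 0 0) 0 with h0 | h0
      · simp [hZ, psd_col_zero A hA h0 j]
      · simp [hZ, h0]
    have hSs := ((psd_iff _).1 hS).1
    have hrow : ∀ j, (A - Z) 0 j = 0 := fun j => by rw [hSs]; exact hcol j
    have hZp : (Z.map (fun y => y ^ γ)).PosSemidef := by
      have h1 := (psd_rankOne (fun i => A i 0 ^ γ)).smul
        (inv_nonneg.2 (Real.rpow_nonneg (hn 0 0) γ))
      convert h1 using 1
      ext i j
      simp only [hZ, Matrix.map_apply, Matrix.of_apply, Matrix.smul_apply, smul_eq_mul]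
      rw [Real.div_rpow (mul_nonneg (hn _ _) (hn _ _)) (hn _ _),
        Real.mul_rpow (hn _ _) (hn _ _)]
      ring
    have hZpsd : Z.PosSemidef := by
      have h1 := (psd_rankOne (fun i => A i 0)).smul (inv_nonneg.2 (hn 0 0))
      convert h1 using 1
      ext i j
      simp only [hZ, Matrix.of_apply, Matrix.smul_apply, smul_eq_mul]
      ring
    have key := path_psd Z (A - Z) γ (by linarith) hZs hSs (by
      intro t ht0 ht1
      have hCn : ∀ i j, 0 ≤ (Z + t • (A - Z)) i j := by
        intro i j
        have e : (Z + t • (A - Z)) i j = (1 - t) * Z i j + t * A i j := by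
          simp; ring
        rw [e]
        exact add_nonneg (mul_nonneg (by linarith) (hZn _ _)) (mul_nonneg ht0.le (hn _ _))
      have hCp : (Z + t • (A - Z)).PosSemidef := hZpsd.add (hS.smul ht0.le)
      have hsub := ih (γ - 1) (by linarith) ((Z + t • (A - Z)).submatrix Fin.succ Fin.succ)
        (hCp.submatrix _) (fun i j => hCn _ _)
      have hprod := had_psd (hS.submatrix Fin.succ) hsub
      rw [psd_iff] at hprod ⊢
      refine ⟨fun i j => ?_, fun x => ?_⟩
      · simp only [Matrix.hadamard_apply, Matrix.map_apply]
        rw [hSs i j, ((psd_iff _).1 hCp).1 i j]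
      · have := hprod.2 (fun i => x i.succ)
        rw [Fin.sum_univ_succ]
        simp only [Matrix.hadamard_apply, hrow, zero_mul, mul_zero, Finset.sum_const_zero,
          zero_add]
        simp only [Fin.sum_univ_succ (n := m + 2), Matrix.hadamard_apply, hcol, zero_mul,
          mul_zero, zero_add]
        simpa only [Matrix.hadamard_apply, Matrix.map_apply, Matrix.submatrix_apply] using this)
    have := key.add hZp
    simpa using this

/-- Loewner monotonicity -/
theorem pow_mono (m : ℕ) (β : ℝ) (hβ : (m : ℝ) + 1 < β)
    (A C : Matrix (Fin (m + 2)) (Fin (m + 2)) ℝ) (hA : A.PosSemidef) (hC : C.PosSemidef)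
    (hAn : ∀ i j, 0 ≤ A i j) (hCn : ∀ i j, 0 ≤ C i j) :
    ((C + A).map (fun y => y ^ β) - C.map (fun y => y ^ β)).PosSemidef := by
  have hm0 : (0 : ℝ) ≤ m := Nat.cast_nonneg m
  refine path_psd C A β (by linarith) ((psd_iff _).1 hC).1 ((psd_iff _).1 hA).1 ?_
  intro t ht0 ht1
  refine had_psd hA (pow_psd m (β - 1) (by linarith) _ (hC.add (hA.smul ht0.le)) ?_)
  intro i j
  exact add_nonneg (hCn _ _) (mul_nonneg ht0.le (hAn _ _))

theorem super_add (m : ℕ) (α : ℝ) (hα : (m : ℝ) + 2 < α)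
    (A B : Matrix (Fin (m + 2)) (Fin (m + 2)) ℝ) (hA : A.PosSemidef) (hB : B.PosSemidef)
    (hAn : ∀ i j, 0 ≤ A i j) (hBn : ∀ i j, 0 ≤ B i j) :
    ((A + B).map (fun y => y ^ α) - A.map (fun y => y ^ α) - B.map (fun y => y ^ α)).PosSemidef := by
  have hm0 : (0 : ℝ) ≤ m := Nat.cast_nonneg m
  have hAs := ((psd_iff _).1 hA).1
  have hBs := ((psd_iff _).1 hB).1
  rw [psd_iff]
  refine ⟨fun i j => by simp [hAs i j, hBs i j], fun x => ?_⟩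
  have hder : ∀ t : ℝ, HasDerivAt
      (fun t : ℝ => ∑ i, ∑ j, x i * x j * ((A i j + t * B i j) ^ α - (t * B i j) ^ α))
      (∑ i, ∑ j, x i * x j * (B i j * α * (A i j + t * B i j) ^ (α - 1)
        - B i j * α * (t * B i j) ^ (α - 1))) t := by
    intro t
    refine HasDerivAt.fun_sum fun i _ => HasDerivAt.fun_sum fun j _ => ?_
    have h0 : HasDerivAt (fun t : ℝ => t * B i j) (B i j) t := by
      simpa using (hasDerivAt_id t).mul_const (B i j)
    have h1 : HasDerivAt (fun t : ℝ => A i j + t * B i j) (B i j) t := h0.const_add (A i j)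
    exact ((h1.rpow_const (Or.inr (by linarith))).sub
      (h0.rpow_const (Or.inr (by linarith)))).const_mul _
  have hmono : MonotoneOn
      (fun t : ℝ => ∑ i, ∑ j, x i * x j * ((A i j + t * B i j) ^ α - (t * B i j) ^ α))
      (Set.Icc 0 1) := by
    refine monotoneOn_of_deriv_nonneg (convex_Icc 0 1)
      (fun t _ => (hder t).continuousAt.continuousWithinAt)
      (fun t _ => (hder t).differentiableAt.differentiableWithinAt) ?_
    intro t ht
    rw [interior_Icc] at ht
    rw [(hder t).deriv]
    have hp := had_psd hB (pow_mono m (α - 1) (by linarith) A (t • B) hA (hB.smul ht.1.le) hAn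
      (fun i j => mul_nonneg ht.1.le (hBn _ _)))
    have := ((psd_iff _).1 hp).2 x
    have e : (∑ i, ∑ j, x i * x j * (B i j * α * (A i j + t * B i j) ^ (α - 1)
        - B i j * α * (t * B i j) ^ (α - 1)))
        = α * ∑ i, ∑ j, x i * x j *
          (B ⊙ ((t • B + A).map (fun y => y ^ (α - 1))
            - (t • B).map (fun y => y ^ (α - 1)))) i j := by
      simp only [Finset.mul_sum]
      refine Finset.sum_congr rfl fun i _ => Finset.sum_congr rfl fun j _ => ?_
      simp [add_comm]
      ring
    rw [e]
    exact mul_nonneg (by linarith) this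
  have := hmono (Set.left_mem_Icc.2 zero_le_one) (Set.right_mem_Icc.2 zero_le_one) zero_le_one
  simp only [zero_mul, add_zero, one_mul, Real.zero_rpow (show α ≠ 0 by linarith), sub_zero] at this
  have e : (∑ i, ∑ j, x i * x j *
      ((A + B).map (fun y => y ^ α) - A.map (fun y => y ^ α) - B.map (fun y => y ^ α)) i j)
      = (∑ i, ∑ j, x i * x j * ((A i j + B i j) ^ α - (B i j) ^ α))
        - ∑ i, ∑ j, x i * x j * (A i j) ^ α := by
    simp only [← Finset.sum_sub_distrib]
    refine Finset.sum_congr rfl fun i _ => Finset.sum_congr rfl fun j _ => ?_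
    simp
    ring
  rw [e]
  linarith

theorem powF_eq (α : ℝ) (hα : α ≠ 0) : powF α = fun y => y ^ α := by
  ext y
  unfold powF
  split_ifs with h
  · rw [h, Real.zero_rpow hα]
  · rfl

theorem natpow_psd {n : ℕ} (A : Matrix (Fin n) (Fin n) ℝ) (hA : A.PosSemidef) (k : ℕ) :
    (A.map (fun y => y ^ k)).PosSemidef := by
  induction k with
  | zero =>
    convert psd_rankOne (fun _ : Fin n => (1 : ℝ)) using 1
    ext i j; simp
  | succ k ih =>
    convert had_psd ih hA using 1
    ext i j; simp [pow_succ]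

/-- Integer powers, in the form `(A+B)^(k+1) - A^(k+1) - B^(k+1)`. -/
theorem natpow_super {n : ℕ} (A B : Matrix (Fin n) (Fin n) ℝ) (hA : A.PosSemidef)
    (hB : B.PosSemidef) (k : ℕ) :
    ((A + B).map (fun y => y ^ (k + 1)) - A.map (fun y => y ^ (k + 1))
      - B.map (fun y => y ^ (k + 1))).PosSemidef := by
  induction k with
  | zero =>
    convert PosSemidef.zero using 1
    ext i j; simp
  | succ k ih =>
    have h1 := (had_psd ih (hA.add hB)).add
      ((had_psd (natpow_psd A hA (k + 1)) hB).add (had_psd (natpow_psd B hB (k + 1)) hA))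
    convert h1 using 1
    ext i j
    simp
    ring

/-- The set is contained in `[1, ∞)`. -/
theorem ge_one (n : ℕ) (hn : 2 ≤ n) (α : ℝ)
    (h : ∀ A B : Matrix (Fin n) (Fin n) ℝ, A.PosSemidef → B.PosSemidef →
        (∀ i j, 0 ≤ A i j) → (∀ i j, 0 ≤ B i j) →
        ((A + B).map (powF α) - A.map (powF α) - B.map (powF α)).PosSemidef) : 1 ≤ α := by
  have hJ := psd_rankOne (fun _ : Fin n => (1 : ℝ))
  have := (h _ _ hJ hJ (by simp) (by simp)).diag_nonneg (i := ⟨0, by omega⟩)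
  simp [powF] at this
  norm_num at this
  by_contra hlt
  have h2 : (2 : ℝ) ^ α < 2 ^ (1 : ℝ) := Real.rpow_lt_rpow_of_exponent_lt (by norm_num) (by linarith)
  rw [Real.rpow_one] at h2
  linarith

theorem quad_pow {n : ℕ} (v : Fin n → ℝ) (w : Fin n → ℝ) (c : ℝ) :
    ∑ i, ∑ j, v i * v j * (c * (w i * w j)) = c * (∑ i, v i * w i) ^ 2 := by
  rw [pow_two, Finset.sum_mul_sum]
  simp only [Finset.mul_sum]
  refine Finset.sum_congr rfl fun i _ => Finset.sum_congr rfl fun j _ => by ring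

/-- A vector annihilating the integer powers but not the fractional one. -/
theorem exists_vec (n k : ℕ) (hk : k < n) (α : ℝ) (hα : (k : ℝ) < α) :
    ∃ v : Fin n → ℝ, (∀ m : ℕ, 1 ≤ m → m ≤ k → ∑ i, v i * ((2 : ℝ) ^ (i : ℕ)) ^ m = 0) ∧
      ∑ i, v i * ((2 : ℝ) ^ (i : ℕ)) ^ α ≠ 0 := by
  set P : Polynomial ℝ := ∏ m ∈ Finset.Icc 1 k, (Polynomial.X - Polynomial.C ((2 : ℝ) ^ m)) with hP
  have hdeg : P.natDegree < n := by
    rw [hP, Polynomial.natDegree_finsetProd_X_sub_C_eq_card]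
    simpa using hk
  have hev : ∀ y : ℝ, ∑ i : Fin n, P.coeff i * y ^ (i : ℕ) = P.eval y := by
    intro y
    rw [Polynomial.eval_eq_sum_range' hdeg, Finset.sum_range]
  refine ⟨fun i => P.coeff i, ?_, ?_⟩
  · intro m h1 h2
    have : ∀ i : Fin n, ((2 : ℝ) ^ (i : ℕ)) ^ m = ((2 : ℝ) ^ m) ^ (i : ℕ) := fun i => by
      rw [← pow_mul, ← pow_mul, mul_comm]
    simp only [this, hev]
    rw [hP, Polynomial.eval_prod]
    exact Finset.prod_eq_zero (Finset.mem_Icc.2 ⟨h1, h2⟩) (by simp)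
  · have : ∀ i : Fin n, ((2 : ℝ) ^ (i : ℕ)) ^ α = ((2 : ℝ) ^ α) ^ (i : ℕ) := fun i => by
      rw [← Real.rpow_natCast, ← Real.rpow_natCast, ← Real.rpow_mul (by norm_num),
        ← Real.rpow_mul (by norm_num), mul_comm]
    simp only [this, hev]
    rw [hP, Polynomial.eval_prod, Finset.prod_ne_zero_iff]
    intro m hm
    have hm2 := (Finset.mem_Icc.1 hm).2
    have : (2 : ℝ) ^ m < 2 ^ α := by
      rw [← Real.rpow_natCast]
      refine Real.rpow_lt_rpow_of_exponent_lt (by norm_num) ?_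
      have : (m : ℝ) ≤ k := by exact_mod_cast hm2
      linarith
    simp
    linarith

theorem not_mem (n k : ℕ) (hk : k < n) (α : ℝ) (h1 : (k : ℝ) < α) (h2 : α < k + 1)
    (h : ∀ A B : Matrix (Fin n) (Fin n) ℝ, A.PosSemidef → B.PosSemidef →
        (∀ i j, 0 ≤ A i j) → (∀ i j, 0 ≤ B i j) →
        ((A + B).map (powF α) - A.map (powF α) - B.map (powF α)).PosSemidef) : False := by
  have hα0 : α ≠ 0 := by
    have : (0 : ℝ) ≤ k := Nat.cast_nonneg k
    linarith
  obtain ⟨v, hv, hvα⟩ := exists_vec n k hk α h1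
  set u : Fin n → ℝ := fun i => (2 : ℝ) ^ (i : ℕ) with hu
  have hup : ∀ i, 0 < u i := fun i => by simp [hu]
  set p := binomialSeries ℝ α
  set R : ℝ → ℝ := fun y => (1 + y) ^ α - p.partialSum (k + 1) y with hR
  have hO : R =O[nhds 0] fun y => ‖y‖ ^ (k + 1) := by
    have := (Real.one_add_rpow_hasFPowerSeriesAt_zero (a := α)).isBigO_sub_partialSum_pow (k + 1)
    simpa only [zero_add] using this
  have hsum : ∀ y, p.partialSum (k + 1) y = 1 + ∑ m ∈ Finset.Icc 1 k, Ring.choose α m * y ^ m := by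
    intro y
    rw [FormalMultilinearSeries.partialSum, Finset.range_eq_Ico,
      Finset.sum_eq_sum_Ico_succ_bot (Nat.succ_pos k)]
    congr 1
    · simp only [p, binomialSeries_apply]
      simp
    · refine Finset.sum_congr (by ext; simp) fun m _ => ?_
      simp only [p, binomialSeries_apply]
      simp
  -- the quadratic form
  have hq : ∀ ε : ℝ, 0 < ε → ε ^ α * (∑ i, v i * u i ^ α) ^ 2
      ≤ ∑ i, ∑ j, v i * v j * R (ε * (u i * u j)) := by
    intro ε hε
    have hJ := psd_rankOne (fun _ : Fin n => (1 : ℝ))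
    have hB := (psd_rankOne u).smul hε.le
    have := ((psd_iff _).1 (h _ _ hJ hB (by simp)
      (fun i j => mul_nonneg hε.le (mul_nonneg (hup i).le (hup j).le)))).2 v
    rw [powF_eq α hα0] at this
    have e : ∀ i j, v i * v j * ((Matrix.of (fun i j : Fin n => (1 : ℝ) * 1) +
        ε • Matrix.of (fun i j => u i * u j)).map (fun y => y ^ α)
        - (Matrix.of (fun i j : Fin n => (1 : ℝ) * 1)).map (fun y => y ^ α)
        - (ε • Matrix.of (fun i j => u i * u j)).map (fun y => y ^ α)) i j
        = v i * v j * R (ε * (u i * u j))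
          + (∑ m ∈ Finset.Icc 1 k, v i * v j * ((Ring.choose α m * ε ^ m) * (u i ^ m * u j ^ m)))
          - v i * v j * (ε ^ α * (u i ^ α * u j ^ α)) := by
      intro i j
      have e1 : (ε * (u i * u j)) ^ α = ε ^ α * (u i ^ α * u j ^ α) := by
        rw [Real.mul_rpow hε.le (mul_nonneg (hup i).le (hup j).le),
          Real.mul_rpow (hup i).le (hup j).le]
      have e2 : (∑ m ∈ Finset.Icc 1 k, v i * v j * ((Ring.choose α m * ε ^ m) * (u i ^ m * u j ^ m)))
          = v i * v j * ∑ m ∈ Finset.Icc 1 k, Ring.choose α m * (ε * (u i * u j)) ^ m := by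
        rw [Finset.mul_sum]
        refine Finset.sum_congr rfl fun m _ => ?_
        rw [mul_pow, mul_pow]; ring
      rw [e2, ← e1, hR]
      simp only [hsum]
      simp
      ring
    simp only [e, Finset.sum_sub_distrib, Finset.sum_add_distrib] at this
    rw [quad_pow v (fun i => u i ^ α) (ε ^ α)] at this
    have e3 : ∑ i, ∑ j, ∑ m ∈ Finset.Icc 1 k,
        v i * v j * ((Ring.choose α m * ε ^ m) * (u i ^ m * u j ^ m)) = 0 := by
      have : ∀ i, ∑ j, ∑ m ∈ Finset.Icc 1 k,
        v i * v j * ((Ring.choose α m * ε ^ m) * (u i ^ m * u j ^ m))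
        = ∑ m ∈ Finset.Icc 1 k, ∑ j,
        v i * v j * ((Ring.choose α m * ε ^ m) * (u i ^ m * u j ^ m)) := fun i =>
          Finset.sum_comm
      simp only [this]
      rw [Finset.sum_comm]
      refine Finset.sum_eq_zero fun m hm => ?_
      rw [quad_pow v (fun i => u i ^ m), hv m (Finset.mem_Icc.1 hm).1 (Finset.mem_Icc.1 hm).2]
      simp
    rw [e3] at this
    linarith
  -- asymptotics
  have hO2 : (fun ε : ℝ => ∑ i, ∑ j, v i * v j * R (ε * (u i * u j)))
      =O[nhdsWithin 0 (Set.Ioi 0)] fun ε : ℝ => ε ^ ((k : ℝ) + 1) := by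
    refine Asymptotics.IsBigO.fun_sum fun i _ => Asymptotics.IsBigO.fun_sum fun j _ => ?_
    refine Asymptotics.IsBigO.const_mul_left ?_ _
    have ht : Filter.Tendsto (fun ε : ℝ => ε * (u i * u j)) (nhdsWithin 0 (Set.Ioi 0)) (nhds 0) := by
      have : Filter.Tendsto (fun ε : ℝ => ε * (u i * u j)) (nhds 0) (nhds (0 * (u i * u j))) :=
        (continuous_id.mul continuous_const).tendsto 0
      rw [zero_mul] at this
      exact this.mono_left nhdsWithin_le_nhds
    refine (hO.comp_tendsto ht).trans ?_
    refine Asymptotics.IsBigO.of_bound ((u i * u j) ^ (k + 1)) ?_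
    filter_upwards [self_mem_nhdsWithin] with ε hε
    have hε : 0 < ε := hε
    have hpos := mul_pos (hup i) (hup j)
    have e : ε ^ ((k : ℝ) + 1) = ε ^ (k + 1) := by
      rw [← Real.rpow_natCast]; push_cast; rfl
    rw [e]
    simp only [Function.comp, norm_pow, norm_mul, norm_norm]
    rw [mul_pow, Real.norm_of_nonneg (hup i).le, Real.norm_of_nonneg (hup j).le]
    exact le_of_eq (mul_comm _ _)
  have ho : (fun ε : ℝ => ε ^ ((k : ℝ) + 1)) =o[nhdsWithin 0 (Set.Ioi 0)] fun ε : ℝ => ε ^ α := by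
    refine (Asymptotics.isLittleO_iff_tendsto' ?_).2 ?_
    · filter_upwards [self_mem_nhdsWithin] with ε hε h0
      exact absurd h0 (Real.rpow_pos_of_pos hε _).ne'
    · have hc : Filter.Tendsto (fun ε : ℝ => ε ^ ((k : ℝ) + 1 - α)) (nhdsWithin 0 (Set.Ioi 0))
          (nhds 0) := by
        have := (Real.continuousAt_rpow_const (0 : ℝ) ((k : ℝ) + 1 - α) (Or.inr (by linarith))).tendsto
        rw [Real.zero_rpow (by linarith)] at this
        exact this.mono_left nhdsWithin_le_nhds
      refine hc.congr' ?_
      filter_upwards [self_mem_nhdsWithin] with ε hε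
      exact Real.rpow_sub hε _ _
  have hlo := hO2.trans_isLittleO ho
  set c := (∑ i, v i * u i ^ α) ^ 2 with hc
  have hcpos : 0 < c := by positivity
  have hb := hlo.bound (half_pos hcpos)
  obtain ⟨ε, hb, hε⟩ := (hb.and self_mem_nhdsWithin).exists
  have hε : 0 < ε := hε
  have := hq ε hε
  have hp := Real.rpow_pos_of_pos hε α
  rw [Real.norm_of_nonneg hp.le] at hb
  have := le_trans this (le_trans (le_abs_self _) hb)
  nlinarith [mul_pos hp hcpos]

/-- The set of powers `α` such that `(A, B) ↦ (A+B)^{∘α} - A^{∘α} - B^{∘α}` is positive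
semidefinite on `P_n([0,∞))` equals `ℕ ∪ [n, ∞)` (`ℕ` the positive integers). -/
theorem stmt11 (n : ℕ) (hn : 2 ≤ n) :
    {α : ℝ | ∀ A B : Matrix (Fin n) (Fin n) ℝ, A.PosSemidef → B.PosSemidef →
        (∀ i j, 0 ≤ A i j) → (∀ i j, 0 ≤ B i j) →
        ((A + B).map (powF α) - A.map (powF α) - B.map (powF α)).PosSemidef}
      = {α : ℝ | ∃ k : ℕ, 0 < k ∧ α = k} ∪ Set.Ici (n : ℝ) := by
  apply Set.Subset.antisymm
  · intro α h
    simp only [Set.mem_ofPred_eq] at h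
    have h1 := ge_one n hn α h
    by_contra hcon
    simp only [Set.mem_union, Set.mem_ofPred_eq, Set.mem_Ici, not_or, not_exists, not_and,
      not_le] at hcon
    obtain ⟨hint, hlt⟩ := hcon
    have hfl : (⌊α⌋₊ : ℝ) ≤ α := Nat.floor_le (by linarith)
    have hk1 : 0 < ⌊α⌋₊ := Nat.floor_pos.2 h1
    have hkn : ⌊α⌋₊ < n := by
      have : (⌊α⌋₊ : ℝ) < n := by linarith
      exact_mod_cast this
    exact not_mem n ⌊α⌋₊ hkn α (lt_of_le_of_ne hfl (Ne.symm (hint _ hk1)))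
      (Nat.lt_floor_add_one α) h
  · have hnat : ∀ k : ℕ, 0 < k → ∀ A B : Matrix (Fin n) (Fin n) ℝ, A.PosSemidef → B.PosSemidef →
        ((A + B).map (powF k) - A.map (powF k) - B.map (powF k)).PosSemidef := by
      intro k hk A B hA hB
      obtain ⟨l, rfl⟩ : ∃ l, k = l + 1 := ⟨k - 1, by omega⟩
      rw [powF_eq _ (by positivity)]
      simp only [Real.rpow_natCast]
      exact natpow_super A B hA hB l
    rintro α (⟨k, hk, rfl⟩ | hα)
    · intro A B hA hB _ _
      exact hnat k hk A B hA hB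
    · intro A B hA hB hAn hBn
      rw [Set.mem_Ici] at hα
      rcases eq_or_lt_of_le hα with rfl | hlt
      · exact hnat n (by omega) A B hA hB
      · obtain ⟨m, rfl⟩ : ∃ m, n = m + 2 := ⟨n - 2, by omega⟩
        have hm0 : (0 : ℝ) ≤ m := Nat.cast_nonneg m
        push_cast at hlt
        rw [powF_eq α (by linarith)]
        exact super_add m α hlt A B hA hB hAn hBn
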